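/- Let ν ∈ (0,1) with ν ≠ 1/2, let R > 0, and set S = 18/(−ν² + ν + 2) − R, T = (1/18)·( 9 − (ν+1)·R·((ν−2)·R + 6) ), U = (1/18)·( −(ν−2)(ν+1)·R² − 6(ν+4)·R + 9(ν−14)/(ν−2) ). Then there is no ε > 0 and no function λ : (−ε,ε) → ℂ such that λ(θ) is an eigenvalue of A(ν,θ;R,S,T,U) for all θ ∈ (−ε,ε) and λ(θ) − e^{−Iνθ} = O(θ⁶) as θ → 0. That is, no choice of parameters yields a fifth-order correct principal eigenvalue except when ν ∈ {0, 1/2, 1}. -/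

import Mathlib

open Complex Matrix

/-- The amplification matrix of the parameterized Active Flux scheme. -/
noncomputable def ampMatrix (ν θ R S T U : ℝ) : Matrix (Fin 2) (Fin 2) ℂ :=
  !![1 - (ν : ℂ) * (1 + (1 - (ν : ℂ)) * ((U : ℂ) - (T : ℂ))) *
        (1 - Complex.exp (-Complex.I * (θ : ℂ))),
      (ν : ℂ) * (1 - (ν : ℂ)) * ((U : ℂ) * Complex.exp (-Complex.I * (θ : ℂ)) - (T : ℂ)) *
        (1 - Complex.exp (-Complex.I * (θ : ℂ)));
      (ν : ℂ) * (1 - (ν : ℂ)) * ((R : ℂ) + (S : ℂ)),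
      (1 - (ν : ℂ)) * (1 - (ν : ℂ) * (R : ℂ)) +
        (ν : ℂ) * (1 - (1 - (ν : ℂ)) * (S : ℂ)) * Complex.exp (-Complex.I * (θ : ℂ))]


open Asymptotics Filter Topology

theorem det_sub_smul_one_eq_of_det_eq_zero {K : Type*} [CommRing K] (A : Matrix (Fin 2) (Fin 2) K)
    {x : K} (hx : Matrix.det (A - x • (1 : Matrix (Fin 2) (Fin 2) K)) = 0) (y : K) :
    Matrix.det (A - y • (1 : Matrix (Fin 2) (Fin 2) K)) =
      (y - x) * ((x - y) + (2 * y - A.trace)) := by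
  simp only [Matrix.det_fin_two, Matrix.trace_fin_two, Matrix.sub_apply, Matrix.smul_apply,
    smul_eq_mul, Matrix.one_apply_eq, Matrix.one_apply_ne (zero_ne_one : (0 : Fin 2) ≠ 1),
    Matrix.one_apply_ne (one_ne_zero : (1 : Fin 2) ≠ 0)] at hx ⊢
  linear_combination hx

theorem continuous_ampMatrix (ν R S T U : ℝ) :
    Continuous fun θ : ℝ => ampMatrix ν θ R S T U := by
  refine continuous_matrix fun i j => ?_
  fin_cases i <;> fin_cases j <;> simp [ampMatrix] <;> fun_prop

theorem det_ampMatrix_sub_smul_one (ν θ R S T U : ℝ) (y : ℂ) :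
    Matrix.det (ampMatrix ν θ R S T U - y • (1 : Matrix (Fin 2) (Fin 2) ℂ)) =
      (1 - ν * (1 + (1 - ν) * (U - T)) * (1 - Complex.exp (-Complex.I * θ)) - y) *
        ((1 - ν) * (1 - ν * R) + ν * (1 - (1 - ν) * S) * Complex.exp (-Complex.I * θ) - y) -
      (ν * (1 - ν)) ^ 2 * (R + S) * (U * Complex.exp (-Complex.I * θ) - T) *
        (1 - Complex.exp (-Complex.I * θ)) := by
  simp only [ampMatrix, Matrix.det_fin_two, Matrix.sub_apply, Matrix.smul_apply, smul_eq_mul,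
    Matrix.one_apply_eq, Matrix.one_apply_ne (zero_ne_one : (0 : Fin 2) ≠ 1),
    Matrix.one_apply_ne (one_ne_zero : (1 : Fin 2) ≠ 0), Matrix.of_apply, Matrix.cons_val_zero,
    Matrix.cons_val_one, Matrix.cons_val']
  ring

/-- If `lam` is an eigenvalue of `A` close to `μ` to order `n`, then `μ` satisfies the
characteristic equation to order `n`. -/
theorem isBigO_det_sub_smul_one {A : ℝ → Matrix (Fin 2) (Fin 2) ℂ} {lam μ : ℝ → ℂ} {n : ℕ}
    (hA : ContinuousAt A 0) (hμ : ContinuousAt μ 0)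
    (hlam : ∀ᶠ θ in 𝓝 0, Matrix.det (A θ - lam θ • (1 : Matrix (Fin 2) (Fin 2) ℂ)) = 0)
    (h : (fun θ => lam θ - μ θ) =O[𝓝 0] fun θ : ℝ => θ ^ n) :
    (fun θ => Matrix.det (A θ - μ θ • (1 : Matrix (Fin 2) (Fin 2) ℂ)))
      =O[𝓝 0] fun θ : ℝ => θ ^ n := by
  have hpow : (fun θ : ℝ => θ ^ n) =O[𝓝 0] fun _ => (1 : ℝ) :=
    (continuous_pow n).continuousAt.isBigO_one ℝ
  have htr : ContinuousAt (fun θ => 2 * μ θ - (A θ).trace) 0 :=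
    (continuousAt_const.mul hμ).sub
      ((continuous_id.matrix_trace).continuousAt.comp (f := A) hA)
  have hbdd := (h.trans hpow).add (htr.isBigO_one ℝ)
  have hprod := h.neg_left.mul hbdd
  simp only [mul_one, neg_sub] at hprod
  refine hprod.congr' ?_ EventuallyEq.rfl
  filter_upwards [hlam] with θ hθ
  exact (det_sub_smul_one_eq_of_det_eq_zero (A θ) hθ (μ θ)).symm

theorem isBigO_exp_mul_sub_sum_range (a : ℂ) (n : ℕ) :
    (fun θ : ℝ => Complex.exp (a * θ) - ∑ i ∈ Finset.range n, (a * θ) ^ i / i.factorial)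
      =O[𝓝 0] fun θ : ℝ => θ ^ n := by
  have ht : Tendsto (fun θ : ℝ => a * (θ : ℂ)) (𝓝 0) (𝓝 0) := by
    have : Continuous fun θ : ℝ => a * (θ : ℂ) := by fun_prop
    simpa using this.tendsto 0
  refine ((Complex.exp_sub_sum_range_isBigO_pow n).comp_tendsto ht).trans ?_
  refine IsBigO.pow ?_ n
  exact IsBigO.of_bound ‖a‖ (by simp)

theorem not_isBigO_const_mul_pow {c : ℂ} (hc : c ≠ 0) (n : ℕ) :
    ¬ (fun θ : ℝ => c * (θ : ℂ) ^ n) =O[𝓝 0] fun θ : ℝ => θ ^ (n + 1) := by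
  intro h
  have hlit : (fun θ : ℝ => c * (θ : ℂ) ^ n) =o[𝓝 0] fun θ : ℝ => θ ^ n :=
    h.trans_isLittleO (isLittleO_pow_pow n.lt_succ_self)
  have hself : (fun θ : ℝ => θ ^ n) =o[𝓝 0] fun θ : ℝ => θ ^ n := by
    rw [isLittleO_const_mul_left_iff hc] at hlit
    exact hlit.norm_left.congr_left (fun θ => by simp) |>.of_norm_left
  refine isLittleO_irrefl ?_ hself
  have : ∃ᶠ θ : ℝ in 𝓝[≠] 0, θ ^ n ≠ 0 :=
    Eventually.frequently (eventually_mem_nhdsWithin.mono fun θ hθ => pow_ne_zero n hθ)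
  exact this.filter_mono nhdsWithin_le_nhds

/-- The leading term of the defect of the exact amplification factor in the characteristic
equation. -/
theorem isBigO_det_ampMatrix_sub_leading (ν R : ℝ) (h₁ : ν + 1 ≠ 0) (h₂ : ν - 2 ≠ 0) :
    (fun θ : ℝ => Matrix.det (ampMatrix ν θ R
              (18 / (-ν ^ 2 + ν + 2) - R)
              ((1 / 18) * (9 - (ν + 1) * R * ((ν - 2) * R + 6)))
              ((1 / 18) * (-((ν - 2) * (ν + 1) * R ^ 2) - 6 * (ν + 4) * R +
                9 * (ν - 14) / (ν - 2))) -
            Complex.exp (-Complex.I * (ν : ℂ) * (θ : ℂ)) • (1 : Matrix (Fin 2) (Fin 2) ℂ)) -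
        (ν : ℂ) ^ 2 * (1 - ν) ^ 2 * (1 - 2 * ν) / 30 * Complex.I * (θ : ℂ) ^ 5)
      =O[𝓝 0] fun θ : ℝ => θ ^ 6 := by
  have hD : (-ν ^ 2 + ν + 2 : ℂ) = -((ν + 1) * (ν - 2)) := by ring
  have hc₁ : (ν + 1 : ℂ) ≠ 0 := by exact_mod_cast h₁
  have hc₂ : (ν - 2 : ℂ) ≠ 0 := by exact_mod_cast h₂
  set v : ℂ := (ν : ℂ) with hv
  set r : ℂ := (R : ℂ) with hr
  set S : ℂ := 18 / (-v ^ 2 + v + 2) - r with hS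
  set T : ℂ := (1 / 18) * (9 - (v + 1) * r * ((v - 2) * r + 6)) with hT
  set U : ℂ := (1 / 18) * (-((v - 2) * (v + 1) * r ^ 2) - 6 * (v + 4) * r +
    9 * (v - 14) / (v - 2)) with hU
  set p : ℂ := v * (1 + (1 - v) * (U - T)) with hp
  set q : ℂ := (1 - v) * (1 - v * r) with hq
  set s : ℂ := v * (1 - (1 - v) * S) with hs
  set k : ℂ := (v * (1 - v)) ^ 2 * (r + S) with hk
  have e := fun a : ℂ => isBigO_exp_mul_sub_sum_range a 6
  have hsum := ((((((e (-Complex.I)).const_mul_left ((1 - p) * s + p * q - k * (U + T))).add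
    ((e (-Complex.I * 2)).const_mul_left (p * s + k * U))).add
    ((e (-Complex.I * v)).const_mul_left (-(1 - p + q)))).add
    ((e (-Complex.I * (1 + v))).const_mul_left (-(p + s)))).add
    (e (-Complex.I * (2 * v))))
  refine hsum.congr_left fun θ => ?_
  have hexp_sq : Complex.exp (-Complex.I * 2 * θ) = Complex.exp (-Complex.I * θ) ^ 2 := by
    rw [← Complex.exp_nat_mul]; congr 1; push_cast; ring
  have hexp_mul : Complex.exp (-Complex.I * (1 + v) * θ) =
      Complex.exp (-Complex.I * θ) * Complex.exp (-Complex.I * v * θ) := by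
    rw [← Complex.exp_add]; congr 1; ring
  have hexp_exact_sq : Complex.exp (-Complex.I * (2 * v) * θ) = Complex.exp (-Complex.I * v * θ) ^ 2 := by
    rw [← Complex.exp_nat_mul]; congr 1; push_cast; ring
  rw [hexp_sq, hexp_mul, hexp_exact_sq]
  have moment_zero : ((1 - p) * q + k * T) + ((1 - p) * s + p * q - k * (U + T)) + (p * s + k * U)
      - (1 - p + q) - (p + s) + 1 = 0 := by
    rw [hk, hp, hq, hs, hS, hU, hT, hD]; field_simp; ring
  have moment (j : ℕ) (hj : j ∈ Finset.Icc 1 4) :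
      ((1 - p) * s + p * q - k * (U + T)) + 2 ^ j * (p * s + k * U)
      - v ^ j * (1 - p + q) - (1 + v) ^ j * (p + s) + (2 * v) ^ j = 0 := by
    rw [hk, hp, hq, hs, hS, hU, hT, hD]
    fin_cases hj <;> field_simp <;> ring
  have moment_five : ((1 - p) * s + p * q - k * (U + T)) + 2 ^ 5 * (p * s + k * U)
      - v ^ 5 * (1 - p + q) - (1 + v) ^ 5 * (p + s) + (2 * v) ^ 5 =
      -4 * (v ^ 2 * (1 - v) ^ 2 * (1 - 2 * v)) := by
    rw [hk, hp, hq, hs, hS, hU, hT, hD]; field_simp; ring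
  have hI : Complex.I ^ 5 = Complex.I := by
    rw [show 5 = 4 + 1 from rfl, pow_succ, Complex.I_pow_four, one_mul]
  rw [det_ampMatrix_sub_smul_one]
  push_cast
  rw [← hv, ← hr, ← hT, ← hU, ← hS, ← hp, ← hq, ← hs, ← hk]
  clear_value p q s k
  simp only [Finset.sum_range_succ, Finset.sum_range_zero, Nat.factorial]
  push_cast
  linear_combination -moment_zero - (-Complex.I * θ) * moment 1 (by decide) - (-Complex.I * θ) ^ 2 / 2 * moment 2 (by decide) -
    (-Complex.I * θ) ^ 3 / 6 * moment 3 (by decide) - (-Complex.I * θ) ^ 4 / 24 * moment 4 (by decide) -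
    (-Complex.I * θ) ^ 5 / 120 * moment_five -
    v ^ 2 * (1 - v) ^ 2 * (1 - 2 * v) / 30 * (θ : ℂ) ^ 5 * hI

open Asymptotics Filter Topology in
theorem no_fifth_order_correct_principal_eigenvalue (ν R : ℝ)
    (hν : ν ∈ Set.Ioo (0 : ℝ) 1) (hν' : ν ≠ 1 / 2) (hR : 0 < R) :
    ¬ ∃ ε > (0 : ℝ), ∃ lam : ℝ → ℂ,
        (∀ θ ∈ Set.Ioo (-ε) ε,
          Matrix.det (ampMatrix ν θ R
              (18 / (-ν ^ 2 + ν + 2) - R)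
              ((1 / 18) * (9 - (ν + 1) * R * ((ν - 2) * R + 6)))
              ((1 / 18) * (-((ν - 2) * (ν + 1) * R ^ 2) - 6 * (ν + 4) * R +
                9 * (ν - 14) / (ν - 2))) -
            lam θ • (1 : Matrix (Fin 2) (Fin 2) ℂ)) = 0) ∧
        (fun θ : ℝ => lam θ - Complex.exp (-Complex.I * (ν : ℂ) * (θ : ℂ)))
          =O[𝓝 0] fun θ : ℝ => θ ^ 6 := by
  rintro ⟨ε, hε, lam, hlam, hO⟩
  have hdet := isBigO_det_sub_smul_one (continuous_ampMatrix ν R _ _ _).continuousAt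
    (by fun_prop) (eventually_of_mem (Ioo_mem_nhds (neg_lt_zero.2 hε) hε) hlam) hO
  have hlead := hdet.sub (isBigO_det_ampMatrix_sub_leading ν R
    (by linarith [hν.1]) (by linarith [hν.2]))
  refine not_isBigO_const_mul_pow ?_ 5 (hlead.congr_left fun θ => sub_sub_cancel _ _)
  have h₀ : (ν : ℂ) ≠ 0 := by exact_mod_cast hν.1.ne'
  have h₁ : (1 - ν : ℂ) ≠ 0 := by exact_mod_cast (sub_pos.2 hν.2).ne'
  have h₂ : (1 - 2 * ν : ℂ) ≠ 0 := by
    have : 1 - 2 * ν ≠ 0 := fun h => hν' (by linarith)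
    exact_mod_cast this
  simp [h₀, h₁, h₂]
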